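/- Let f and g be corner functions with α_f = α_g and ψ_f = ψ_g. If x_f < x_g, then g coincides with the function x ↦ λ f(λ⁻¹ x) where λ = x_g/x_f; but this function does not fix 1, a contradiction. Hence x_f = x_g. -/

import Mathlib

open Set Function

/-- `f` is locally affine at `x`: it agrees with an affine map on a neighbourhood of `x`. -/
def LocallyAffineAt (f : ℝ → ℝ) (x : ℝ) : Prop :=
  ∃ a b : ℝ, ∀ᶠ y in nhds x, f y = a * y + b

/-- `x` is a node of `f`: a point of `(0,1)` at which `f` is not locally affine. -/
def IsNode (f : ℝ → ℝ) (x : ℝ) : Prop :=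
  x ∈ Set.Ioo (0 : ℝ) 1 ∧ ¬ LocallyAffineAt f x

/-- Membership of the group `PLF⁺([0,1])` of orientation-preserving piecewise linear
homeomorphisms of `[0,1]` that are locally affine at all but finitely many points of `(0,1)`.
Such a homeomorphism is modelled as a map `ℝ → ℝ` that equals the identity outside `[0,1]`,
so that composition and (function) inverse model the group structure. -/
structure IsPLF (f : ℝ → ℝ) : Prop where
  map_zero : f 0 = 0
  map_one : f 1 = 1
  strictMonoOn : StrictMonoOn f (Set.Icc 0 1)
  continuousOn : ContinuousOn f (Set.Icc 0 1)
  surjOn : Set.SurjOn f (Set.Icc 0 1) (Set.Icc 0 1)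
  eq_id : ∀ x : ℝ, x ∉ Set.Icc (0 : ℝ) 1 → f x = x
  finite_nodes : {x : ℝ | IsNode f x}.Finite

/-- Membership of `𝓕`: elements of `PLF⁺([0,1])` with `f x > x` on `(0,1)`. -/
def MemF (f : ℝ → ℝ) : Prop :=
  IsPLF f ∧ ∀ x ∈ Set.Ioo (0 : ℝ) 1, x < f x

/-- `f` has at least one node. -/
def HasNode (f : ℝ → ℝ) : Prop := ∃ x, IsNode f x

/-- The left derivative `f'₋(x)`. -/
noncomputable def leftDeriv (f : ℝ → ℝ) (x : ℝ) : ℝ := derivWithin f (Set.Iic x) x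

/-- The right derivative `f'₊(x)`. -/
noncomputable def rightDeriv (f : ℝ → ℝ) (x : ℝ) : ℝ := derivWithin f (Set.Ici x) x

/-- `f*(x) = f'₊(x) / f'₋(x)`. -/
noncomputable def fstar (f : ℝ → ℝ) (x : ℝ) : ℝ := rightDeriv f x / leftDeriv f x

/-- `x_f`, the smallest node of `f` (for `f ∈ 𝓕` with at least one node). -/
noncomputable def firstNode (f : ℝ → ℝ) : ℝ := sInf {x | IsNode f x}

/-- `y_f`, the largest node of `f`. -/
noncomputable def lastNode (f : ℝ → ℝ) : ℝ := sSup {x | IsNode f x}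

/-- `α_f = f'₋(x_f)`. -/
noncomputable def alphaF (f : ℝ → ℝ) : ℝ := leftDeriv f (firstNode f)

/-- `φ_f^a(x) = ∏_{n=0}^∞ f*(fⁿ(x))` (independent of `a` as a formula; `a` only
fixes the domain `[a, f a)`). -/
noncomputable def phi (f : ℝ → ℝ) (x : ℝ) : ℝ := ∏' n : ℕ, fstar f (f^[n] x)

/-- `ψ_f^a(s) = φ_f^a(α_f ^ s * a)`, a function on the circle `𝕊 = [0,1]/(0∼1)`,
represented by its values for `s ∈ [0,1)`. -/
noncomputable def psiA (f : ℝ → ℝ) (a s : ℝ) : ℝ := phi f (alphaF f ^ s * a)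

/-- `ψ_f = ψ_f^{x_f}`. -/
noncomputable def psi (f : ℝ → ℝ) (s : ℝ) : ℝ := psiA f (firstNode f) s

/-- `f` and `g` are conjugate in `PLF⁺([0,1])`: `h f h⁻¹ = g` for some `h` in the group. -/
def IsConjPLF (f g : ℝ → ℝ) : Prop :=
  ∃ h : ℝ → ℝ, IsPLF h ∧ h ∘ f ∘ Function.invFun h = g

/-- A corner function: a member of `𝓕` (with at least one node) all of whose nodes
lie in `[x_f, f x_f)`. -/
def CornerFun (f : ℝ → ℝ) : Prop :=
  MemF f ∧ HasNode f ∧ ∀ x, IsNode f x → x ∈ Set.Ico (firstNode f) (f (firstNode f))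


/-- Continuous induction: a continuous function vanishing at `a`, whose vanishing on `[a, c]`
always propagates slightly to the right of `c`, vanishes on `[a, b]`. -/
theorem eq_zero_of_forall_exists_right {d : ℝ → ℝ} {a b : ℝ} (hd : ContinuousOn d (Icc a b))
    (h0 : d a = 0)
    (step : ∀ c ∈ Ico a b, (∀ y ∈ Icc a c, d y = 0) → ∃ ε > 0, ∀ y ∈ Icc c (c + ε), d y = 0) :
    ∀ y ∈ Icc a b, d y = 0 := by
  intro y hy
  have hab : a ≤ b := hy.1.trans hy.2
  set S : Set ℝ := {c | ∀ y ∈ Icc a b, d (min y c) = 0} with hS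
  have hclosed : IsClosed (S ∩ Icc a b) := by
    have : S ∩ Icc a b =
        ⋂ y ∈ Icc a b, (Icc a b ∩ (fun c => d (min y c)) ⁻¹' {0}) := by
      ext c
      simp only [hS, mem_inter_iff, mem_ofPred_eq, mem_iInter, mem_preimage, mem_singleton_iff]
      exact ⟨fun h y hy => ⟨h.2, h.1 y hy⟩,
        fun h => ⟨fun y hy => (h y hy).2, (h a (left_mem_Icc.2 hab)).1⟩⟩
    rw [this]
    refine isClosed_biInter fun y hy => ?_
    refine ContinuousOn.preimage_isClosed_of_isClosed (hd.comp (by fun_prop) ?_) isClosed_Icc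
      isClosed_singleton
    exact fun c hc => ⟨le_min hy.1 hc.1, (min_le_left _ _).trans hy.2⟩
  have ha : a ∈ S := fun y hy => by rw [min_eq_right hy.1, h0]
  have hsub : Icc a b ⊆ S := by
    refine hclosed.Icc_subset_of_forall_exists_gt ha ?_
    rintro c ⟨hcS, hc⟩ z hz
    have hleft : ∀ y ∈ Icc a c, d y = 0 := fun y hy => by
      simpa [min_eq_left hy.2] using hcS y ⟨hy.1, hy.2.trans hc.2.le⟩
    obtain ⟨ε, hε, hright⟩ := step c hc hleft
    refine ⟨min (c + ε) z, ?_, lt_min (by linarith) hz, min_le_right _ _⟩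
    intro y hy
    rcases le_total y c with hyc | hyc
    · exact hleft _ ⟨le_min hy.1 (le_min (by linarith [hc.1]) (hc.1.trans (le_of_lt hz))),
        (min_le_left _ _).trans hyc⟩
    · exact hright _ ⟨le_min hyc (le_min (by linarith) (le_of_lt hz)),
        (min_le_right _ _).trans (min_le_left _ _)⟩
  simpa [min_eq_left hy.2] using hsub (right_mem_Icc.2 hab) y hy

/-- A continuous function that is locally affine inside an interval is affine on it. -/
theorem exists_affine_of_locallyAffineAt {f : ℝ → ℝ} {a b : ℝ} (hab : a < b)
    (hf : ContinuousOn f (Icc a b)) (h : ∀ x ∈ Ioo a b, LocallyAffineAt f x) :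
    ∃ m k : ℝ, ∀ y ∈ Icc a b, f y = m * y + k := by
  have hloc : ∀ x ∈ Ioo a b, ∃ m, ∀ᶠ y in nhds x, HasDerivAt f m y := by
    intro x hx
    obtain ⟨m, k, hmk⟩ := h x hx
    refine ⟨m, hmk.eventually_nhds.mono fun y hy => ?_⟩
    have : HasDerivAt (fun y => m * y + k) m y := by
      simpa using ((hasDerivAt_id y).const_mul m).add_const k
    exact this.congr_of_eventuallyEq hy
  have hdiff : ∀ x ∈ Ioo a b, HasDerivAt f (deriv f x) x := fun x hx => by
    obtain ⟨m, hm⟩ := hloc x hx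
    exact hm.self_of_nhds.differentiableAt.hasDerivAt
  have hdd : ∀ x ∈ Ioo a b, HasDerivAt (deriv f) 0 x := fun x hx => by
    obtain ⟨m, hm⟩ := hloc x hx
    exact (hasDerivAt_const x m).congr_of_eventuallyEq (hm.mono fun y hy => hy.deriv)
  obtain ⟨m, hm⟩ := isOpen_Ioo.exists_is_const_of_deriv_eq_zero isPreconnected_Ioo
    (fun x hx => (hdd x hx).differentiableAt.differentiableWithinAt)
    (fun x hx => (hdd x hx).deriv)
  have hg : ∀ x ∈ Ioo a b, HasDerivAt (fun y => f y - m * y) 0 x := fun x hx => by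
    have := (hdiff x hx).sub ((hasDerivAt_id x).const_mul m)
    rw [hm x hx, mul_one, sub_self] at this
    exact this
  obtain ⟨k, hk⟩ := isOpen_Ioo.exists_is_const_of_deriv_eq_zero isPreconnected_Ioo
    (fun x hx => (hg x hx).differentiableAt.differentiableWithinAt)
    (fun x hx => (hg x hx).deriv)
  refine ⟨m, k, ?_⟩
  have : EqOn f (fun y => m * y + k) (Ioo a b) := fun x hx => by
    have := hk x hx
    simp only at this ⊢
    linarith
  exact this.of_subset_closure hf (by fun_prop) Ioo_subset_Icc_self
    (by rw [closure_Ioo hab.ne])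

theorem rightDeriv_eq {f : ℝ → ℝ} {c m k b : ℝ} (hb : c < b)
    (h : ∀ y ∈ Icc c b, f y = m * y + k) : rightDeriv f c = m := by
  have h1 : HasDerivWithinAt (fun y => m * y + k) m (Ici c) c := by
    simpa using (((hasDerivAt_id c).const_mul m).add_const k).hasDerivWithinAt
  refine (h1.congr_of_eventuallyEq ?_ (h c (left_mem_Icc.2 hb.le))).derivWithin
    (uniqueDiffOn_Ici c c self_mem_Ici)
  filter_upwards [Icc_mem_nhdsGE hb] using h

theorem leftDeriv_eq {f : ℝ → ℝ} {c m k a : ℝ} (ha : a < c)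
    (h : ∀ y ∈ Icc a c, f y = m * y + k) : leftDeriv f c = m := by
  have h1 : HasDerivWithinAt (fun y => m * y + k) m (Iic c) c := by
    simpa using (((hasDerivAt_id c).const_mul m).add_const k).hasDerivWithinAt
  refine (h1.congr_of_eventuallyEq ?_ (h c (right_mem_Icc.2 ha.le))).derivWithin
    (uniqueDiffOn_Iic c c self_mem_Iic)
  filter_upwards [Icc_mem_nhdsLE ha] using h

namespace IsPLF

variable {f : ℝ → ℝ} {c : ℝ}

theorem mem_Ioo (hf : IsPLF f) (hc : c ∈ Ioo (0 : ℝ) 1) : f c ∈ Ioo (0 : ℝ) 1 := by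
  have h0 := hf.strictMonoOn (by simp) (Ioo_subset_Icc_self hc) hc.1
  have h1 := hf.strictMonoOn (Ioo_subset_Icc_self hc) (by simp) hc.2
  rw [hf.map_zero] at h0
  rw [hf.map_one] at h1
  exact ⟨h0, h1⟩

theorem eventually_not_isNode (hf : IsPLF f) (c : ℝ) :
    ∃ ε > 0, ∀ y, y ≠ c → |y - c| < ε → ¬ IsNode f y := by
  have := (hf.finite_nodes.subset (sdiff_subset (t := {c}))).isClosed.isOpen_compl.mem_nhds
    (show c ∈ ({x | IsNode f x} \ {c})ᶜ by simp)
  obtain ⟨ε, hε, h⟩ := Metric.mem_nhds_iff.1 this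
  exact ⟨ε, hε, fun y hy hyc hn => h (by simpa [Real.dist_eq] using hyc) ⟨hn, hy⟩⟩

theorem exists_affine (hf : IsPLF f) {a b : ℝ} (ha : 0 ≤ a) (hab : a < b) (hb : b ≤ 1)
    (h : ∀ x ∈ Ioo a b, ¬ IsNode f x) : ∃ m k : ℝ, ∀ y ∈ Icc a b, f y = m * y + k := by
  refine exists_affine_of_locallyAffineAt hab (hf.continuousOn.mono (Icc_subset_Icc ha hb)) ?_
  intro x hx
  by_contra hx'
  exact h x hx ⟨⟨ha.trans_lt hx.1, hx.2.trans_le hb⟩, hx'⟩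

/-- On each side of an interior point, a piecewise linear map is affine with slope the
corresponding one-sided derivative. -/
theorem exists_affine_sides (hf : IsPLF f) (hc : c ∈ Ioo (0 : ℝ) 1) :
    0 < leftDeriv f c ∧ ∃ ε > 0,
      (∀ y ∈ Icc c (c + ε), f y = f c + rightDeriv f c * (y - c)) ∧
      (∀ y ∈ Icc (c - ε) c, f y = f c + leftDeriv f c * (y - c)) := by
  obtain ⟨ε₀, hε₀, hn⟩ := hf.eventually_not_isNode c
  obtain ⟨ε, hε, hlt⟩ := exists_between (lt_min hε₀ (lt_min hc.1 (sub_pos.2 hc.2)))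
  obtain ⟨hlt₀, hlt₁, hlt₂⟩ : ε < ε₀ ∧ ε < c ∧ ε < 1 - c := by simpa using hlt
  obtain ⟨r, k, hr⟩ := hf.exists_affine (a := c) (b := c + ε) hc.1.le (by linarith) (by linarith)
    fun x hx => hn x hx.1.ne' (by rw [abs_lt]; constructor <;> linarith [hx.1, hx.2])
  obtain ⟨l, k', hl⟩ := hf.exists_affine (a := c - ε) (b := c) (by linarith) (by linarith) hc.2.le
    fun x hx => hn x hx.2.ne (by rw [abs_lt]; constructor <;> linarith [hx.1, hx.2])
  have hr' := rightDeriv_eq (by linarith) hr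
  have hl' := leftDeriv_eq (by linarith) hl
  have hrc := hr c ⟨le_rfl, by linarith⟩
  have hlc := hl c ⟨by linarith, le_rfl⟩
  refine ⟨?_, ε, hε, fun y hy => ?_, fun y hy => ?_⟩
  · have h1 := hf.strictMonoOn (a := c - ε) (b := c) ⟨by linarith, by linarith [hc.2]⟩
      (Ioo_subset_Icc_self hc) (by linarith)
    rw [hl _ ⟨le_rfl, by linarith⟩, hlc] at h1
    rw [hl']
    nlinarith
  · rw [hr y hy, hrc, hr']; ring
  · rw [hl y hy, hlc, hl']; ring

theorem fstar_eq_one (hf : IsPLF f) (hc : c ∈ Ioo (0 : ℝ) 1) (hn : ¬ IsNode f c) :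
    fstar f c = 1 := by
  have hla : LocallyAffineAt f c := by
    by_contra h
    exact hn ⟨hc, h⟩
  obtain ⟨m, k, h⟩ := hla
  obtain ⟨ε, hε, h⟩ := Metric.nhds_basis_closedBall.eventually_iff.1 h
  rw [Real.closedBall_eq_Icc] at h
  have hr : rightDeriv f c = m := rightDeriv_eq (b := c + ε) (by linarith)
    fun y hy => h ⟨by linarith [hy.1], hy.2⟩
  have hl : leftDeriv f c = m := leftDeriv_eq (a := c - ε) (by linarith)
    fun y hy => h ⟨hy.1, by linarith [hy.2]⟩
  have hpos := (hf.exists_affine_sides hc).1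
  rw [fstar, hr, ← hl, div_self hpos.ne']

end IsPLF

namespace CornerFun

variable {f g : ℝ → ℝ} {x : ℝ}

theorem isNode_firstNode (hf : CornerFun f) : IsNode f (firstNode f) :=
  Set.Nonempty.csInf_mem (s := {x | IsNode f x}) hf.2.1 hf.1.1.finite_nodes

theorem eq_mul (hf : CornerFun f) (hx : x ∈ Icc 0 (firstNode f)) : f x = alphaF f * x := by
  have hn := hf.isNode_firstNode.1
  obtain ⟨m, k, h⟩ := hf.1.1.exists_affine le_rfl hn.1 hn.2.le
    fun x hx hx' => (hf.2.2 x hx').1.not_gt hx.2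
  have h0 := h 0 ⟨le_rfl, hn.1.le⟩
  rw [hf.1.1.map_zero] at h0
  rw [alphaF, leftDeriv_eq hn.1 h, h x hx]
  linarith

theorem one_lt_alphaF (hf : CornerFun f) : 1 < alphaF f := by
  have hn := hf.isNode_firstNode.1
  have h := hf.1.2 _ hn
  rw [hf.eq_mul ⟨hn.1.le, le_rfl⟩] at h
  nlinarith [hn.1]

theorem fstar_eq_one (hf : CornerFun f) (hx : alphaF f * firstNode f ≤ x) (hx1 : x < 1) :
    fstar f x = 1 := by
  have hn := hf.isNode_firstNode.1
  refine hf.1.1.fstar_eq_one ⟨?_, hx1⟩ fun h => ?_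
  · exact (mul_pos (zero_lt_one.trans hf.one_lt_alphaF) hn.1).trans_le hx
  · have := (hf.2.2 x h).2
    rw [hf.eq_mul ⟨hn.1.le, le_rfl⟩] at this
    linarith

theorem phi_eq (hf : CornerFun f) (hx : x ∈ Ico (firstNode f) 1) : phi f x = fstar f x := by
  have hn := hf.isNode_firstNode.1
  have hiter : ∀ n, f^[n] x ∈ Ico (firstNode f) 1 := by
    intro n
    induction n with
    | zero => exact hx
    | succ n ih =>
      rw [iterate_succ_apply']
      have hmem : f^[n] x ∈ Ioo (0 : ℝ) 1 := ⟨hn.1.trans_le ih.1, ih.2⟩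
      exact ⟨ih.1.trans (hf.1.2 _ hmem).le, (hf.1.1.mem_Ioo hmem).2⟩
  refine tprod_eq_mulSingle 0 fun n hn0 => ?_
  refine hf.fstar_eq_one ?_ (hiter n).2
  obtain ⟨n, rfl⟩ := Nat.exists_eq_succ_of_ne_zero hn0
  rw [iterate_succ_apply', ← hf.eq_mul ⟨hn.1.le, le_rfl⟩]
  exact hf.1.1.strictMonoOn.monotoneOn (Ioo_subset_Icc_self hn)
    ⟨hn.1.le.trans (hiter n).1, (hiter n).2.le⟩ (hiter n).1

theorem psi_eq (hf : CornerFun f) {s : ℝ} (hs : s ∈ Ico (0 : ℝ) 1) :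
    psi f s = fstar f (alphaF f ^ s * firstNode f) := by
  have hn := hf.isNode_firstNode.1
  have hα := hf.one_lt_alphaF
  refine hf.phi_eq ⟨le_mul_of_one_le_left hn.1.le (Real.one_le_rpow hα.le hs.1), ?_⟩
  have h1 : alphaF f ^ s < alphaF f := by
    simpa using Real.rpow_lt_rpow_of_exponent_lt hα hs.2
  have h2 := (hf.1.1.mem_Ioo hn).2
  rw [hf.eq_mul ⟨hn.1.le, le_rfl⟩] at h2
  exact (mul_lt_mul_of_pos_right h1 hn.1).trans h2

theorem fstar_scale (hf : CornerFun f) (hg : CornerFun g) (ha : alphaF f = alphaF g)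
    (hpsi : ∀ s ∈ Ico (0 : ℝ) 1, psi f s = psi g s) {t : ℝ} (ht : 1 ≤ t)
    (htf : t * firstNode f < 1) (htg : t * firstNode g < 1) :
    fstar f (t * firstNode f) = fstar g (t * firstNode g) := by
  have hnf := hf.isNode_firstNode.1
  have hng := hg.isNode_firstNode.1
  have hα := hf.one_lt_alphaF
  rcases lt_or_ge t (alphaF f) with h | h
  · have ht0 : 0 < t := by linarith
    have hs : Real.logb (alphaF f) t ∈ Ico (0 : ℝ) 1 :=
      ⟨Real.logb_nonneg hα ht, by rwa [Real.logb_lt_iff_lt_rpow hα ht0, Real.rpow_one]⟩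
    have key := hpsi _ hs
    rwa [hf.psi_eq hs, hg.psi_eq hs, ← ha,
      Real.rpow_logb (by linarith) hα.ne' ht0] at key
  · rw [hf.fstar_eq_one (mul_le_mul_of_nonneg_right h hnf.1.le) htf,
      hg.fstar_eq_one (mul_le_mul_of_nonneg_right (ha ▸ h) hng.1.le) htg]

theorem not_firstNode_lt (hf : CornerFun f) (hg : CornerFun g) (ha : alphaF f = alphaF g)
    (hpsi : ∀ s ∈ Ico (0 : ℝ) 1, psi f s = psi g s) : ¬ firstNode f < firstNode g := by
  intro hlt
  have hnf := hf.isNode_firstNode.1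
  have hng := hg.isNode_firstNode.1
  obtain ⟨q, hq⟩ : ∃ q, q = firstNode f / firstNode g := ⟨_, rfl⟩
  have hq0 : 0 < q := hq ▸ div_pos hnf.1 hng.1
  have hq1 : q < 1 := hq ▸ (div_lt_one hng.1).2 hlt
  have hqg : q * firstNode g = firstNode f := by rw [hq, div_mul_cancel₀ _ hng.1.ne']
  have hmaps : MapsTo (fun x => q * x) (Icc 0 1) (Icc 0 1) := fun x hx =>
    ⟨mul_nonneg hq0.le hx.1, by nlinarith [hx.1, hx.2]⟩
  have hinit : ∀ x ∈ Icc 0 (firstNode g), q * g x - f (q * x) = 0 := by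
    intro x hx
    rw [hg.eq_mul hx, hf.eq_mul ⟨mul_nonneg hq0.le hx.1,
      hqg ▸ mul_le_mul_of_nonneg_left hx.2 hq0.le⟩, ha]
    ring
  have hzero : ∀ x ∈ Icc (0 : ℝ) 1, q * g x - f (q * x) = 0 := by
    refine eq_zero_of_forall_exists_right (d := fun x => q * g x - f (q * x)) ?_
      (hinit 0 ⟨le_rfl, hng.1.le⟩) ?_
    · exact (hg.1.1.continuousOn.const_smul q).sub
        (hf.1.1.continuousOn.comp (by fun_prop) hmaps)
    intro c hc hleft
    rcases lt_or_ge c (firstNode g) with hcg | hcg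
    · exact ⟨firstNode g - c, sub_pos.2 hcg, fun y hy =>
        hinit y ⟨hc.1.trans hy.1, by linarith [hy.2]⟩⟩
    have hc0 : 0 < c := hng.1.trans_le hcg
    have hqc : q * c < 1 := by nlinarith [hc.2]
    obtain ⟨hlg, ε, hε, hgr, hgl⟩ := hg.1.1.exists_affine_sides ⟨hc0, hc.2⟩
    obtain ⟨hlf, δ, hδ, hfr, hfl⟩ := hf.1.1.exists_affine_sides ⟨mul_pos hq0 hc0, hqc⟩
    have hstar : fstar f (q * c) = fstar g c := by
      have h := hf.fstar_scale hg ha hpsi (t := c / firstNode g) ((one_le_div hng.1).2 hcg)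
      have e1 : c / firstNode g * firstNode g = c := div_mul_cancel₀ _ hng.1.ne'
      have e2 : c / firstNode g * firstNode f = q * c := by rw [hq]; ring
      rw [e1, e2] at h
      exact h hqc hc.2
    have hval := hleft c ⟨hc.1, le_rfl⟩
    have hl : leftDeriv f (q * c) = leftDeriv g c := by
      obtain ⟨η, hη, hηlt⟩ := exists_between (lt_min hε (lt_min hδ hc0))
      obtain ⟨h1, h2, h3⟩ : η < ε ∧ η < δ ∧ η < c := by simpa using hηlt
      have h := hleft (c - η) ⟨by linarith, by linarith⟩
      have hqη : q * η < η := by nlinarith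
      rw [hgl _ ⟨by linarith, by linarith⟩, hfl _ ⟨by linarith, by nlinarith⟩] at h
      have : (leftDeriv f (q * c) - leftDeriv g c) * (q * η) = 0 := by linear_combination h - hval
      have hne : q * η ≠ 0 := (mul_pos hq0 hη).ne'
      exact sub_eq_zero.1 ((mul_eq_zero.1 this).resolve_right hne)
    have hr : rightDeriv f (q * c) = rightDeriv g c := by
      rw [fstar, fstar, hl] at hstar
      exact (div_left_inj' hlg.ne').1 hstar
    refine ⟨min ε δ, lt_min hε hδ, fun y hy => ?_⟩
    have hyε : y ≤ c + ε := hy.2.trans (by linarith [min_le_left ε δ])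
    have hyδ : y ≤ c + δ := hy.2.trans (by linarith [min_le_right ε δ])
    rw [hgr y ⟨hy.1, hyε⟩, hfr (q * y) ⟨by nlinarith [hy.1], by nlinarith⟩, hr]
    linear_combination hval
  have h1 := hzero 1 (by simp)
  have h2 := hf.1.2 q ⟨hq0, hq1⟩
  rw [hg.1.1.map_one, mul_one] at h1
  linarith

end CornerFun

/-- If `f` and `g` are corner functions with `α_f = α_g` and `ψ_f = ψ_g`, then
`x_f = x_g` (if `x_f < x_g` then `g` would coincide with `x ↦ λ f(λ⁻¹ x)`, `λ = x_g/x_f`,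
which does not fix `1` — a contradiction). -/
theorem corner_firstNode_eq (f g : ℝ → ℝ) (hf : CornerFun f) (hg : CornerFun g)
    (ha : alphaF f = alphaF g)
    (hpsi : ∀ s ∈ Set.Ico (0 : ℝ) 1, psi f s = psi g s) :
    firstNode f = firstNode g := by
  refine le_antisymm ?_ ?_
  · exact not_lt.1 (hg.not_firstNode_lt hf ha.symm fun s hs => (hpsi s hs).symm)
  · exact not_lt.1 (hf.not_firstNode_lt hg ha hpsi)
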